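/- arXiv:1812.11329 — 3 statements merged into one kernel-verified Lean document; each statement's English description precedes it below -/
import Mathlib

section
/- Let f : ℝ^d → ℝ be lower semicontinuous, sign-invariant, with f(0) = 0 and f(x + y) ≥ f(x) for all x, y ∈ ℝ^d with nonnegative entries, and let λ ≥ 0. Then for every y ∈ ℝ^d with all entries nonnegative, (f + λ‖·‖₁)*(y) = f*((y − λ𝟏)₊), where 𝟏 is the all-ones vector and (v)₊ denotes componentwise max(vᵢ, 0). -/
noncomputable section

open scoped BigOperators

/-- ℓ¹ norm on ℝ^d -/
def l1 {d : ℕ} (x : Fin d → ℝ) : ℝ := ∑ i, |x i|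

/-- Euclidean inner product on ℝ^d -/
def ip {d : ℕ} (x y : Fin d → ℝ) : ℝ := ∑ i, x i * y i

/-- Fenchel conjugate `g*(y) = sup_x ⟨x,y⟩ − g(x)` -/
def fconj {d : ℕ} (g : (Fin d → ℝ) → ℝ) (y : Fin d → ℝ) : ℝ := ⨆ x, ip x y - g x

/-- Real suprema of two families that dominate each other agree, even when unbounded. -/
theorem Real.iSup_eq_of_forall_exists_le {ι κ : Type*} {u : ι → ℝ} {v : κ → ℝ}
    (huv : ∀ i, ∃ k, u i ≤ v k) (hvu : ∀ k, ∃ i, v k ≤ u i) :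
    ⨆ i, u i = ⨆ k, v k := by
  have hset : upperBounds (Set.range u) = upperBounds (Set.range v) := by
    ext b
    simp only [mem_upperBounds, Set.forall_mem_range]
    refine ⟨fun h k => ?_, fun h i => ?_⟩
    · obtain ⟨i, hi⟩ := hvu k
      exact hi.trans (h i)
    · obtain ⟨k, hk⟩ := huv i
      exact hk.trans (h k)
  by_cases hb : BddAbove (Set.range u)
  · have hb' : BddAbove (Set.range v) := by
      rwa [BddAbove, ← hset]
    rcases isEmpty_or_nonempty ι with hι | ⟨⟨i⟩⟩
    · have : IsEmpty κ := ⟨fun k => hι.false (hvu k).choose⟩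
      simp [Real.iSup_of_isEmpty]
    · have : Nonempty ι := ⟨i⟩
      have : Nonempty κ := ⟨(huv i).choose⟩
      have hlub := isLUB_ciSup hb
      rw [IsLUB, hset] at hlub
      exact hlub.unique (isLUB_ciSup hb')
  · have hb' : ¬ BddAbove (Set.range v) := by
      rwa [BddAbove, ← hset]
    rw [Real.iSup_of_not_bddAbove hb, Real.iSup_of_not_bddAbove hb']

/-- A sign-invariant function depends only on the absolute values of the coordinates. -/
theorem apply_abs_of_sign_invariant {d : ℕ} {f : (Fin d → ℝ) → ℝ}
    (hsign : ∀ (ε x : Fin d → ℝ), (∀ i, ε i = 1 ∨ ε i = -1) →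
      f (fun i => ε i * x i) = f x) (x : Fin d → ℝ) :
    f (fun i => |x i|) = f x := by
  rw [← hsign (fun i => if 0 ≤ x i then 1 else -1) x fun i => ite_eq_or_eq _ _ _]
  congr 1
  ext i
  split_ifs with h
  · rw [abs_of_nonneg h, one_mul]
  · rw [abs_of_neg (not_le.mp h), neg_one_mul]

/-- `(f + λ‖·‖₁)*(y) = f*((y − λ𝟏)₊)` for componentwise nonnegative `y`. -/
theorem stmt2 {d : ℕ} (f : (Fin d → ℝ) → ℝ) (lam : ℝ) (hlam : 0 ≤ lam)
    (hlsc : LowerSemicontinuous f)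
    (hsign : ∀ (ε x : Fin d → ℝ), (∀ i, ε i = 1 ∨ ε i = -1) →
      f (fun i => ε i * x i) = f x)
    (h0 : f 0 = 0)
    (hmono : ∀ x y : Fin d → ℝ, (∀ i, 0 ≤ x i) → (∀ i, 0 ≤ y i) → f x ≤ f (x + y))
    (y : Fin d → ℝ) (hy : ∀ i, 0 ≤ y i) :
    fconj (fun v => f v + lam * l1 v) y = fconj f (fun i => max (y i - lam) 0) := by
  have habs := apply_abs_of_sign_invariant hsign
  refine Real.iSup_eq_of_forall_exists_le (fun x => ⟨fun i => |x i|, ?_⟩)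
    (fun x => ⟨fun i => if lam < y i then |x i| else 0, ?_⟩)
  · have hsum : ip x y - lam * l1 x ≤ ip (fun i => |x i|) (fun i => max (y i - lam) 0) := by
      simp only [ip, l1, Finset.mul_sum, ← Finset.sum_sub_distrib]
      refine Finset.sum_le_sum fun i _ => ?_
      have h₁ := mul_le_mul_of_nonneg_right (le_abs_self (x i)) (hy i)
      have h₂ := mul_le_mul_of_nonneg_left (le_max_left (y i - lam) 0) (abs_nonneg (x i))
      linarith
    rw [habs x]
    linarith
  · set t : Fin d → ℝ := fun i => if lam < y i then |x i| else 0 with ht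
    have hf : f t ≤ f x := by
      have h := hmono t (fun i => if lam < y i then 0 else |x i|)
        (fun i => by simp only [ht]; split_ifs <;> positivity)
        (fun i => by split_ifs <;> positivity)
      have hadd : t + (fun i => if lam < y i then 0 else |x i|) = fun i => |x i| := by
        ext i
        simp only [ht, Pi.add_apply]
        split_ifs <;> simp
      rwa [hadd, habs x] at h
    have hsum : ip x (fun i => max (y i - lam) 0) ≤ ip t y - lam * l1 t := by
      simp only [ip, l1, Finset.mul_sum, ← Finset.sum_sub_distrib]
      refine Finset.sum_le_sum fun i _ => ?_
      simp only [ht]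
      split_ifs with h
      · rw [max_eq_left (by linarith), abs_abs]
        have := mul_le_mul_of_nonneg_right (le_abs_self (x i)) (sub_nonneg.mpr h.le)
        linarith
      · rw [max_eq_right (by linarith)]
        simp
    linarith
end
end

section
/- Let μ > 0, λ ≥ 0, δ ∈ (0, 1), and let g_λ : ℝ → ℝ be g_λ(x) = μ − max(√μ − |x|, 0)² + λ|x| + x². Suppose x', z' ∈ ℝ satisfy 2z' ∈ ∂g_λ(x') and |z'| ∉ [(1−δ)√μ + λ/2, √μ/(1−δ) + λ/2]. Then for every x'' ≠ x' and every z'' with 2z'' ∈ ∂g_λ(x''), one has (z'' − z')(x'' − x') > δ (x'' − x')². -/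
noncomputable section

/-- subdifferential of a function `g : ℝ → ℝ` at `x` -/
def subdiff (g : ℝ → ℝ) (x : ℝ) : Set ℝ :=
  {s : ℝ | ∀ y : ℝ, g x + s * (y - x) ≤ g y}

/-- `g_λ(x) = μ − max(√μ − |x|, 0)² + λ|x| + x²` -/
def gfun (μ lam x : ℝ) : ℝ :=
  μ - max (Real.sqrt μ - |x|) 0 ^ 2 + lam * |x| + x ^ 2

theorem gfun_neg (μ lam x : ℝ) : gfun μ lam (-x) = gfun μ lam x := by
  simp [gfun]

theorem neg_mem_subdiff_gfun {μ lam x z : ℝ} (h : 2 * z ∈ subdiff (gfun μ lam) x) :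
    2 * (-z) ∈ subdiff (gfun μ lam) (-x) := by
  intro y
  have hy := h (-y)
  rw [gfun_neg] at hy ⊢
  linarith

/-- On the positive half-line, the derivative of `gfun` is `2`-Lipschitz, whence this quadratic
upper bound. -/
theorem gfun_le_of_pos (μ lam : ℝ) {x y : ℝ} (hx : 0 < x) (hy : 0 < y) :
    gfun μ lam y ≤ gfun μ lam x + (2 * max (√μ) x + lam) * (y - x) + (y - x) ^ 2 := by
  have hs := Real.sqrt_nonneg μ
  simp only [gfun, abs_of_pos hx, abs_of_pos hy]
  rcases le_total (√μ) x with h | h <;> rcases le_total (√μ) y with h' | h'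
  · rw [max_eq_right (by linarith : √μ - x ≤ 0), max_eq_right (by linarith : √μ - y ≤ 0),
      max_eq_right h]
    nlinarith
  · rw [max_eq_right (by linarith : √μ - x ≤ 0), max_eq_left (by linarith : 0 ≤ √μ - y),
      max_eq_right h]
    nlinarith [sq_nonneg (√μ - y)]
  · rw [max_eq_left (by linarith : 0 ≤ √μ - x), max_eq_right (by linarith : √μ - y ≤ 0),
      max_eq_left h]
    nlinarith [mul_nonneg (sub_nonneg.2 h) (sub_nonneg.2 h')]
  · rw [max_eq_left (by linarith : 0 ≤ √μ - x), max_eq_left (by linarith : 0 ≤ √μ - y),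
      max_eq_left h]
    nlinarith [sq_nonneg (y - x)]

theorem eq_of_mem_subdiff_gfun_of_pos {μ lam x z : ℝ} (hx : 0 < x)
    (h : 2 * z ∈ subdiff (gfun μ lam) x) : z = max (√μ) x + lam / 2 := by
  by_contra hne
  set d := z - (max (√μ) x + lam / 2) with hd
  have hd0 : d ≠ 0 := sub_ne_zero.2 hne
  have hda : 0 < |d| := abs_pos.2 hd0
  set t := x / (|d| + x) with ht
  have ht0 : 0 < t := by positivity
  have ht1 : t < 1 := (div_lt_one (by positivity)).2 (by linarith)
  have hdt : |d| * t < x := by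
    have : t * (|d| + x) = x := div_mul_cancel₀ _ (by positivity)
    nlinarith
  have hy : 0 < x + d * t := by
    nlinarith [neg_abs_le d]
  have h1 := h (x + d * t)
  have h2 := gfun_le_of_pos μ lam hx hy
  have h3 : 2 * d * (d * t) ≤ (d * t) ^ 2 := by
    rw [hd] at *
    linarith
  have h4 : 0 < d ^ 2 * t := by positivity
  nlinarith

theorem eq_of_mem_subdiff_gfun_of_neg {μ lam x z : ℝ} (hx : x < 0)
    (h : 2 * z ∈ subdiff (gfun μ lam) x) : z = -(max (√μ) (-x) + lam / 2) := by
  have := eq_of_mem_subdiff_gfun_of_pos (neg_pos.2 hx) (neg_mem_subdiff_gfun h)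
  linarith

theorem le_of_mem_subdiff_gfun_zero {μ lam z : ℝ} (hμ : 0 < μ)
    (h : 2 * z ∈ subdiff (gfun μ lam) 0) : z ≤ √μ + lam / 2 := by
  have hs := Real.sqrt_pos.2 hμ
  have h1 := h (√μ)
  simp only [gfun, abs_of_pos hs, abs_zero, sub_self, max_self, sub_zero,
    max_eq_left hs.le] at h1
  have h2 := Real.sq_sqrt hμ.le
  nlinarith

theorem abs_le_of_mem_subdiff_gfun_zero {μ lam z : ℝ} (hμ : 0 < μ)
    (h : 2 * z ∈ subdiff (gfun μ lam) 0) : |z| ≤ √μ + lam / 2 := by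
  have hneg := neg_mem_subdiff_gfun h
  rw [neg_zero] at hneg
  exact abs_le'.2 ⟨le_of_mem_subdiff_gfun_zero hμ h, le_of_mem_subdiff_gfun_zero hμ hneg⟩

/-- Growth at the origin, for a subgradient whose modulus is small. -/
theorem subdiff_gfun_growth_zero {μ lam δ z' x'' z'' : ℝ} (hδ : δ ∈ Set.Ioo (0 : ℝ) 1)
    (hz' : |z'| < (1 - δ) * √μ + lam / 2) (hx : 0 < x'')
    (hz'' : 2 * z'' ∈ subdiff (gfun μ lam) x'') : δ * x'' ^ 2 < (z'' - z') * x'' := by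
  obtain ⟨h0, h1⟩ := hδ
  have hz := eq_of_mem_subdiff_gfun_of_pos hx hz''
  have hs := le_max_left (√μ) x''
  have hm := le_max_right (√μ) x''
  have : δ * x'' < z'' - z' := by
    nlinarith [le_abs_self z']
  nlinarith

/-- Growth at a point of the positive half-line that is far from the origin. -/
theorem subdiff_gfun_growth_of_pos {μ lam δ x' z' x'' z'' : ℝ} (hμ : 0 < μ) (hlam : 0 ≤ lam)
    (hδ : δ ∈ Set.Ioo (0 : ℝ) 1) (hx' : 0 < x') (hz' : 2 * z' ∈ subdiff (gfun μ lam) x')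
    (hout : |z'| ∉ Set.Icc ((1 - δ) * √μ + lam / 2) (√μ / (1 - δ) + lam / 2))
    (hne : x'' ≠ x') (hz'' : 2 * z'' ∈ subdiff (gfun μ lam) x'') :
    δ * (x'' - x') ^ 2 < (z'' - z') * (x'' - x') := by
  obtain ⟨h0, h1⟩ := hδ
  have hs := Real.sqrt_pos.2 hμ
  have hz := eq_of_mem_subdiff_gfun_of_pos hx' hz'
  have hsm := le_max_left (√μ) x'
  have hbig : √μ / (1 - δ) < max (√μ) x' := by
    by_contra! hle
    refine hout ⟨?_, ?_⟩ <;> rw [abs_of_pos (by linarith)]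
    · nlinarith
    · linarith
  have hfar : √μ < x' * (1 - δ) := by
    refine (div_lt_iff₀ (by linarith)).1 ((lt_max_iff.1 hbig).resolve_left ?_)
    exact not_lt.2 (le_div_self hs.le (by linarith) (by linarith))
  have hsx : √μ < x' := by nlinarith
  rw [max_eq_right hsx.le] at hz
  have near (hw : 0 ≤ x'') (hx : x'' < x') (hzw : z'' ≤ √μ + lam / 2) :
      δ * (x'' - x') ^ 2 < (z'' - z') * (x'' - x') := by
    have : δ * (x' - x'') < z' - z'' := by nlinarith
    nlinarith
  rcases lt_trichotomy x'' 0 with hx | rfl | hx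
  · have hw := eq_of_mem_subdiff_gfun_of_neg hx hz''
    have hm := le_max_right (√μ) (-x'')
    have : δ * (x' - x'') < z' - z'' := by nlinarith
    nlinarith
  · exact near le_rfl hx' (le_of_mem_subdiff_gfun_zero hμ hz'')
  · have hw := eq_of_mem_subdiff_gfun_of_pos hx hz''
    rcases le_total x'' (√μ) with h | h
    · rw [max_eq_left h] at hw
      exact near hx.le (by linarith) hw.le
    · rw [max_eq_right h] at hw
      have : 0 < (x'' - x') ^ 2 := sq_pos_of_ne_zero (sub_ne_zero.2 hne)
      nlinarith

/-- Scalar version of Lemma 2 (subgradient growth estimate). -/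
theorem stmt8 (μ lam δ : ℝ) (hμ : 0 < μ) (hlam : 0 ≤ lam) (hδ : δ ∈ Set.Ioo (0:ℝ) 1)
    (x' z' : ℝ) (hz' : 2 * z' ∈ subdiff (gfun μ lam) x')
    (hout : |z'| ∉
      Set.Icc ((1 - δ) * Real.sqrt μ + lam / 2) (Real.sqrt μ / (1 - δ) + lam / 2)) :
    ∀ x'' : ℝ, x'' ≠ x' → ∀ z'' : ℝ, 2 * z'' ∈ subdiff (gfun μ lam) x'' →
      (z'' - z') * (x'' - x') > δ * (x'' - x') ^ 2 := by
  intro x'' hne z'' hz''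
  rcases lt_trichotomy x' 0 with hx | rfl | hx
  · have := subdiff_gfun_growth_of_pos hμ hlam hδ (neg_pos.2 hx) (neg_mem_subdiff_gfun hz')
      (by rwa [abs_neg]) (neg_injective.ne hne) (neg_mem_subdiff_gfun hz'')
    linarith
  · have hs := Real.sqrt_pos.2 hμ
    have hsmall : |z'| < (1 - δ) * √μ + lam / 2 := by
      by_contra! hle
      have := le_div_self hs.le (by linarith [hδ.2] : 0 < 1 - δ) (by linarith [hδ.1])
      exact hout ⟨hle, by linarith [abs_le_of_mem_subdiff_gfun_zero hμ hz']⟩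
    rcases hne.lt_or_gt with hx | hx
    · have := subdiff_gfun_growth_zero (z' := -z') hδ (by rwa [abs_neg]) (neg_pos.2 hx)
        (neg_mem_subdiff_gfun hz'')
      linarith
    · simpa using subdiff_gfun_growth_zero hδ hsmall hx hz''
  · exact subdiff_gfun_growth_of_pos hμ hlam hδ hx hz' hout hne hz''
end
end

section
/- Let f : ℝ^d → ℝ be lower semicontinuous, sign-invariant, with f(0) = 0 and f(x + y) ≥ f(x) for all x, y ∈ ℝ^d with nonnegative entries, and let λ ≥ 0, γ > 0, ρ > 0. Then for every y ∈ ℝ^d, the set of minimizers of x ↦ (1/ρ)·Q_γ(f + λ‖·‖₁)(x) + ‖x − y‖² equals the set of minimizers of x ↦ (1/ρ)·Q_γ(f)(x) + ‖x − w‖², where w is the soft-thresholding of y given componentwise by wᵢ = sign(yᵢ)·max(|yᵢ| − λ/(2ρ), 0); that is, prox_{Q_γ(f + λ‖·‖₁)/ρ}(y) = prox_{Q_γ(f)/ρ}(prox_{λ‖·‖₁/ρ}(y)). -/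
noncomputable section

open scoped BigOperators

/-- squared Euclidean norm on ℝ^d -/
def sqnorm {d : ℕ} (x : Fin d → ℝ) : ℝ := ∑ i, (x i) ^ 2

/-- quadratic envelope `Q_γ(f)(x) = (f + (γ/2)‖·‖²)**(x) − (γ/2)‖x‖²` -/
def Qγ {d : ℕ} (γ : ℝ) (f : (Fin d → ℝ) → ℝ) (x : Fin d → ℝ) : ℝ :=
  fconj (fconj fun v => f v + γ / 2 * sqnorm v) x - γ / 2 * sqnorm x

def softThreshold (τ t : ℝ) : ℝ := Real.sign t * max (|t| - τ) 0

lemma abs_sub_softThreshold_le {τ : ℝ} (hτ : 0 ≤ τ) (t : ℝ) : |t - softThreshold τ t| ≤ τ := by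
  unfold softThreshold
  rcases lt_trichotomy t 0 with h | h | h
  · rw [Real.sign_of_neg h, abs_of_neg h, abs_le]
    rcases max_cases (-t - τ) 0 with h' | h' <;> constructor <;> linarith
  · simpa [h] using hτ
  · rw [Real.sign_of_pos h, abs_of_pos h, abs_le]
    rcases max_cases (t - τ) 0 with h' | h' <;> constructor <;> linarith

lemma sign_softThreshold_mul_sub {τ : ℝ} (hτ : 0 ≤ τ) (t : ℝ) :
    Real.sign (softThreshold τ t) * (t - softThreshold τ t) =
      τ * |Real.sign (softThreshold τ t)| := by
  rcases le_or_gt |t| τ with h | h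
  · simp [softThreshold, max_eq_right (sub_nonpos.2 h)]
  · rcases lt_trichotomy t 0 with h' | h' | h'
    · have e : softThreshold τ t = t + τ := by
        rw [softThreshold, max_eq_left (by linarith), Real.sign_of_neg h', abs_of_neg h']; ring
      rw [abs_of_neg h'] at h
      rw [e, Real.sign_of_neg (by linarith)]; simp
    · simp only [h', abs_zero] at h; linarith
    · have e : softThreshold τ t = t - τ := by
        rw [softThreshold, max_eq_left (by linarith), Real.sign_of_pos h', abs_of_pos h']; ring
      rw [abs_of_pos h'] at h
      rw [e, Real.sign_of_pos (by linarith)]; simp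

lemma abs_sign_le_one (t : ℝ) : |Real.sign t| ≤ 1 := by
  rcases Real.sign_apply_eq t with h | h | h <;> simp [h]

lemma abs_sign_mul_abs_le (t v : ℝ) : |Real.sign t * (|v|)| ≤ |v| := by
  rw [abs_mul, abs_abs]
  exact mul_le_of_le_one_left (abs_nonneg v) (abs_sign_le_one t)

lemma sign_mul_eq_abs (t : ℝ) : Real.sign t * t = |t| := by
  rcases lt_trichotomy t 0 with h | h | h
  · rw [Real.sign_of_neg h, abs_of_neg h]; ring
  · simp [h]
  · rw [Real.sign_of_pos h, abs_of_pos h]; ring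

/-- Replacing `v` by `sign t * |v|` brings it strictly closer to `t`, unless nothing changes. -/
lemma sq_sign_mul_abs_sub_lt {t v : ℝ} (h : Real.sign t * |v| ≠ v) :
    (Real.sign t * |v| - t) ^ 2 < (v - t) ^ 2 := by
  rcases lt_trichotomy t 0 with ht | ht | ht
  · rw [Real.sign_of_neg ht] at h ⊢
    rcases le_or_gt v 0 with hv | hv
    · rw [abs_of_nonpos hv] at h; simp at h
    · rw [abs_of_pos hv]; nlinarith
  · subst ht
    have : v ≠ 0 := by rintro rfl; simp at h
    simpa using sq_pos_of_ne_zero this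
  · rw [Real.sign_of_pos ht] at h ⊢
    rcases le_or_gt 0 v with hv | hv
    · rw [abs_of_nonneg hv] at h; simp at h
    · rw [abs_of_neg hv]; nlinarith

lemma sq_sign_mul_abs_sub_le (t v : ℝ) : (Real.sign t * |v| - t) ^ 2 ≤ (v - t) ^ 2 := by
  by_cases h : Real.sign t * |v| = v
  · rw [h]
  · exact (sq_sign_mul_abs_sub_lt h).le

lemma exists_abs_eq_mul_eq (v y : ℝ) : ∃ u, |u| = |v| ∧ u * y = |v| * |y| := by
  rcases le_total 0 y with h | h
  · exact ⟨|v|, abs_abs v, by rw [abs_of_nonneg h]⟩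
  · exact ⟨-|v|, by simp, by rw [abs_of_nonpos h]; ring⟩

/-- One-dimensional slope replacement behind the monotonicity of the quadratic envelope. -/
lemma exists_slope {γ x x' : ℝ} (hγ : 0 < γ) (hx : |x| ≤ |x'|) (y : ℝ) :
    ∃ y', ∀ v, ∃ u, |u| ≤ |v| ∧
      (v * y' - γ / 2 * v ^ 2) - (u * y - γ / 2 * u ^ 2) ≤
        (x' * y' - γ / 2 * x' ^ 2) - (x * y - γ / 2 * x ^ 2) := by
  obtain ⟨c, rfl⟩ : ∃ c, y = γ * c := ⟨y / γ, by field_simp⟩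
  have scale : ∀ {A B : ℝ}, A ≤ B → γ / 2 * A ≤ γ / 2 * B := fun h =>
    mul_le_mul_of_nonneg_left h (by positivity)
  have hxc : x * c ≤ |x| * |c| := by rw [← abs_mul]; exact le_abs_self _
  have hx2 := sq_abs x
  have hx2' := sq_abs x'
  have hc2 := sq_abs c
  have h0 := abs_nonneg x
  rcases le_or_gt |x'| |c| with h | h
  · obtain ⟨s, hs, hsx⟩ := exists_abs_eq_mul_eq c x'
    have key : 0 ≤ 2 * (x' * s) - x' ^ 2 - (2 * (x * c) - x ^ 2) := by nlinarith
    refine ⟨γ * s, fun v => ?_⟩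
    have hv2 := sq_abs v
    have hvs : v * s ≤ |v| * |c| := by rw [← hs, ← abs_mul]; exact le_abs_self _
    rcases le_or_gt |v| |c| with hv | hv
    · obtain ⟨u, hu, huc⟩ := exists_abs_eq_mul_eq v c
      have hu2 : u ^ 2 = v ^ 2 := by rw [← sq_abs, hu, sq_abs]
      refine ⟨u, hu.le, ?_⟩
      have := scale (show 2 * (v * s) - v ^ 2 - (2 * (u * c) - u ^ 2) ≤
        2 * (x' * s) - x' ^ 2 - (2 * (x * c) - x ^ 2) by linarith)
      linarith
    · refine ⟨c, hv.le, ?_⟩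
      have := scale (show 2 * (v * s) - v ^ 2 - (2 * (c * c) - c ^ 2) ≤
        2 * (x' * s) - x' ^ 2 - (2 * (x * c) - x ^ 2) by nlinarith [sq_nonneg (|v| - |c|)])
      linarith
  · refine ⟨γ * x', fun v => ?_⟩
    have hv2 := sq_abs v
    have key : x' ^ 2 - c ^ 2 ≤ 2 * (x' * x') - x' ^ 2 - (2 * (x * c) - x ^ 2) := by
      nlinarith [sq_nonneg (x - c)]
    rcases le_or_gt |v| |c| with hv | hv
    · obtain ⟨u, hu, huc⟩ := exists_abs_eq_mul_eq v c
      have hu2 : u ^ 2 = v ^ 2 := by rw [← sq_abs, hu, sq_abs]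
      have hvx : v * x' ≤ |v| * |x'| := by rw [← abs_mul]; exact le_abs_self _
      refine ⟨u, hu.le, ?_⟩
      have := scale (show 2 * (v * x') - v ^ 2 - (2 * (u * c) - u ^ 2) ≤
        2 * (x' * x') - x' ^ 2 - (2 * (x * c) - x ^ 2) by
          nlinarith [sq_nonneg (|x'| - |c|), mul_le_mul_of_nonneg_right hv (sub_nonneg.2 h.le)])
      linarith
    · refine ⟨c, hv.le, ?_⟩
      have := scale (show 2 * (v * x') - v ^ 2 - (2 * (c * c) - c ^ 2) ≤
        2 * (x' * x') - x' ^ 2 - (2 * (x * c) - x ^ 2) by nlinarith [sq_nonneg (v - x')])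
      linarith

section Conjugate

variable {d : ℕ}

lemma ip_comm (x y : Fin d → ℝ) : ip x y = ip y x := by
  simp only [ip, mul_comm]

lemma l1_nonneg (x : Fin d → ℝ) : 0 ≤ l1 x := Finset.sum_nonneg fun _ _ => abs_nonneg _

lemma sqnorm_le_sqnorm {x y : Fin d → ℝ} (h : ∀ i, |x i| ≤ |y i|) : sqnorm x ≤ sqnorm y :=
  Finset.sum_le_sum fun i _ => sq_le_sq.2 (h i)

/-- `g` is monotone in the absolute values of the coordinates. -/
def AbsMonotone (g : (Fin d → ℝ) → ℝ) : Prop :=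
  ∀ ⦃x y : Fin d → ℝ⦄, (∀ i, |x i| ≤ |y i|) → g x ≤ g y

lemma absMonotone_of_sign_invariant {f : (Fin d → ℝ) → ℝ}
    (hsign : ∀ (ε x : Fin d → ℝ), (∀ i, ε i = 1 ∨ ε i = -1) →
      f (fun i => ε i * x i) = f x)
    (hmono : ∀ x y : Fin d → ℝ, (∀ i, 0 ≤ x i) → (∀ i, 0 ≤ y i) → f x ≤ f (x + y)) :
    AbsMonotone f := by
  have habs : ∀ x : Fin d → ℝ, f (fun i => |x i|) = f x := fun x => by
    rw [← hsign (fun i => if 0 ≤ x i then 1 else -1) x fun i => by split_ifs <;> simp]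
    congr 1
    ext i
    split_ifs with h
    · rw [abs_of_nonneg h, one_mul]
    · rw [abs_of_neg (not_le.1 h), neg_one_mul]
  intro x y h
  rw [← habs x, ← habs y]
  convert hmono (fun i => |x i|) (fun i => |y i| - |x i|) (fun i => abs_nonneg _)
    (fun i => sub_nonneg.2 (h i)) using 2
  ext i
  simp

lemma bddAbove_conj {γ : ℝ} (hγ : 0 < γ) {g : (Fin d → ℝ) → ℝ}
    (hg : ∀ x, γ / 2 * sqnorm x ≤ g x) (y : Fin d → ℝ) :
    BddAbove (Set.range fun x => ip x y - g x) := by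
  refine ⟨∑ i, (y i) ^ 2 / (2 * γ), ?_⟩
  rintro _ ⟨x, rfl⟩
  have : ip x y - γ / 2 * sqnorm x ≤ ∑ i, (y i) ^ 2 / (2 * γ) := by
    rw [ip, sqnorm, Finset.mul_sum, ← Finset.sum_sub_distrib]
    refine Finset.sum_le_sum fun i _ => ?_
    rw [le_div_iff₀ (by positivity)]
    nlinarith [sq_nonneg (γ * x i - y i)]
  have := hg x
  dsimp only
  linarith

lemma ip_sub_le_fconj {γ : ℝ} (hγ : 0 < γ) {g : (Fin d → ℝ) → ℝ}
    (hg : ∀ x, γ / 2 * sqnorm x ≤ g x) (x y : Fin d → ℝ) : ip x y - g x ≤ fconj g y :=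
  le_ciSup (bddAbove_conj hγ hg y) x

lemma ip_sub_fconj_le_biconj {γ : ℝ} (hγ : 0 < γ) {g : (Fin d → ℝ) → ℝ}
    (hg : ∀ x, γ / 2 * sqnorm x ≤ g x) (x y : Fin d → ℝ) :
    ip y x - fconj g y ≤ fconj (fconj g) x := by
  refine le_ciSup (f := fun y => ip y x - fconj g y) ⟨g x, ?_⟩ y
  rintro _ ⟨z, rfl⟩
  have := ip_sub_le_fconj hγ hg x z
  dsimp only
  rw [ip_comm z x]
  linarith

lemma ip_le_ip_add_mul_l1 {τ : ℝ} {y z : Fin d → ℝ} (h : ∀ i, |y i - z i| ≤ τ)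
    (x : Fin d → ℝ) : ip x y ≤ ip x z + τ * l1 x := by
  rw [ip, ip, l1, Finset.mul_sum, ← Finset.sum_add_distrib]
  refine Finset.sum_le_sum fun i _ => ?_
  have h1 : x i * (y i - z i) ≤ |x i| * τ :=
    (le_abs_self _).trans <| by
      rw [abs_mul]; exact mul_le_mul_of_nonneg_left (h i) (abs_nonneg _)
  linarith

/-- Adding a multiple of the ℓ¹ norm commutes with taking the biconjugate. -/
lemma biconj_add_l1 {γ τ : ℝ} (hγ : 0 < γ) (hτ : 0 ≤ τ) {g : (Fin d → ℝ) → ℝ}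
    (hg : ∀ x, γ / 2 * sqnorm x ≤ g x) (hmono : AbsMonotone g) (x : Fin d → ℝ) :
    fconj (fconj fun v => g v + τ * l1 v) x = fconj (fconj g) x + τ * l1 x := by
  have hg' : ∀ x, γ / 2 * sqnorm x ≤ g x + τ * l1 x := fun x =>
    (hg x).trans (le_add_of_nonneg_right (mul_nonneg hτ (l1_nonneg x)))
  apply le_antisymm
  · refine ciSup_le fun y => ?_
    let z : Fin d → ℝ := fun i => softThreshold τ (y i)
    have hz : fconj g z ≤ fconj (fun v => g v + τ * l1 v) y := by
      refine ciSup_le fun v => ?_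
      let v' : Fin d → ℝ := fun i => Real.sign (z i) * |v i|
      refine le_trans ?_ (ip_sub_le_fconj hγ hg' v' y)
      have h1 : g v' ≤ g v := hmono fun i => abs_sign_mul_abs_le _ _
      have h2 : ip v z + τ * l1 v' ≤ ip v' y := by
        rw [ip, ip, l1, Finset.mul_sum, ← Finset.sum_add_distrib]
        refine Finset.sum_le_sum fun i _ => ?_
        have h3 := sign_softThreshold_mul_sub hτ (y i)
        have h4 : v i * z i ≤ |v i| * |z i| := by rw [← abs_mul]; exact le_abs_self _
        have h5 := sign_mul_eq_abs (z i)
        have h6 : v' i * y i =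
            |v i| * (Real.sign (z i) * (y i - z i)) + |v i| * (Real.sign (z i) * z i) := by
          simp only [v']; ring
        rw [h6, h5, show Real.sign (z i) * (y i - z i) = τ * |Real.sign (z i)| from h3]
        simp only [v', abs_mul, abs_abs]
        linarith
      linarith
    have h1 := ip_le_ip_add_mul_l1 (fun i => abs_sub_softThreshold_le hτ (y i)) x
    have h2 := ip_sub_fconj_le_biconj hγ hg x z
    rw [ip_comm y x]
    rw [ip_comm z x] at h2
    have h3 : ip x z = ip x fun i => softThreshold τ (y i) := rfl
    linarith
  · rw [← le_sub_iff_add_le]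
    refine ciSup_le fun z => ?_
    let y : Fin d → ℝ := fun i => z i + τ * Real.sign (x i)
    have h1 : fconj (fun v => g v + τ * l1 v) y ≤ fconj g z := by
      refine ciSup_le fun v => le_trans ?_ (ip_sub_le_fconj hγ hg v z)
      have := ip_le_ip_add_mul_l1 (y := y) (z := z) (τ := τ) (fun i => by
        simp only [y, add_sub_cancel_left, abs_mul, abs_of_nonneg hτ]
        exact mul_le_of_le_one_right hτ (abs_sign_le_one _)) v
      linarith
    have h2 : ip y x = ip z x + τ * l1 x := by
      rw [ip, ip, l1, Finset.mul_sum, ← Finset.sum_add_distrib]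
      refine Finset.sum_congr rfl fun i _ => ?_
      rw [← sign_mul_eq_abs]; simp only [y]; ring
    have h3 := ip_sub_fconj_le_biconj hγ hg' x y
    linarith

lemma absMonotone_quadraticEnvelope {γ : ℝ} (hγ : 0 < γ) {f : (Fin d → ℝ) → ℝ}
    (hf : ∀ x, 0 ≤ f x) (hmono : AbsMonotone f) : AbsMonotone (Qγ γ f) := by
  intro x x' hx
  have hg : ∀ x, γ / 2 * sqnorm x ≤ f x + γ / 2 * sqnorm x := fun x =>
    le_add_of_nonneg_left (hf x)
  rw [Qγ, sub_le_iff_le_add]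
  refine ciSup_le fun y => ?_
  choose y' hy' using fun i => exists_slope hγ (hx i) (y i)
  have key : fconj (fun v => f v + γ / 2 * sqnorm v) y' ≤
      fconj (fun v => f v + γ / 2 * sqnorm v) y +
        ((ip x' y' - γ / 2 * sqnorm x') - (ip x y - γ / 2 * sqnorm x)) := by
    refine ciSup_le fun v => ?_
    choose u hu hle using fun i => hy' i (v i)
    have h1 := ip_sub_le_fconj hγ hg u y
    have h2 := hmono hu
    have h3 := Finset.sum_le_sum fun i (_ : i ∈ Finset.univ) => hle i
    simp only [Finset.sum_sub_distrib, ← Finset.mul_sum] at h3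
    simp only [ip, sqnorm] at h1 ⊢
    linarith
  have h := ip_sub_fconj_le_biconj hγ hg x' y'
  rw [ip_comm y x]
  rw [ip_comm y' x'] at h
  rw [Qγ]
  linarith

lemma quadraticEnvelope_add_l1 {γ τ : ℝ} (hγ : 0 < γ) (hτ : 0 ≤ τ) {f : (Fin d → ℝ) → ℝ}
    (hf : ∀ x, 0 ≤ f x) (hmono : AbsMonotone f) (x : Fin d → ℝ) :
    Qγ γ (fun v => f v + τ * l1 v) x = Qγ γ f x + τ * l1 x := by
  have h := biconj_add_l1 (g := fun v => f v + γ / 2 * sqnorm v) hγ hτ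
    (fun x => le_add_of_nonneg_left (hf x))
    (fun x y hxy => add_le_add (hmono hxy)
      (mul_le_mul_of_nonneg_left (sqnorm_le_sqnorm hxy) (by positivity))) x
  have e : (fun v : Fin d → ℝ => f v + τ * l1 v + γ / 2 * sqnorm v) =
      fun v => f v + γ / 2 * sqnorm v + τ * l1 v := by ext v; ring
  rw [Qγ, Qγ, e, h]
  ring

/-- For a function monotone in the absolute values of the coordinates, the proximal operator after
adding an ℓ¹ term factors through soft thresholding. -/
lemma minimizers_add_l1_eq {τ : ℝ} (hτ : 0 ≤ τ) {h : (Fin d → ℝ) → ℝ} (hmono : AbsMonotone h)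
    (y : Fin d → ℝ) :
    {x : Fin d → ℝ | ∀ u, h x + 2 * τ * l1 x + sqnorm (x - y) ≤
        h u + 2 * τ * l1 u + sqnorm (u - y)} =
      {x : Fin d → ℝ | ∀ u, h x + sqnorm (x - fun i => softThreshold τ (y i)) ≤
        h u + sqnorm (u - fun i => softThreshold τ (y i))} := by
  set w : Fin d → ℝ := fun i => softThreshold τ (y i) with hw
  let hat : (Fin d → ℝ) → Fin d → ℝ := fun x i => Real.sign (w i) * |x i|
  have lower : ∀ x, sqnorm (x - w) + (sqnorm y - sqnorm w) ≤ 2 * τ * l1 x + sqnorm (x - y) := by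
    intro x
    have := ip_le_ip_add_mul_l1 (fun i => abs_sub_softThreshold_le hτ (y i)) x
    have e : ∀ z, sqnorm (x - z) = sqnorm x - 2 * ip x z + sqnorm z := fun z => by
      simp only [sqnorm, ip, Finset.mul_sum, ← Finset.sum_sub_distrib, ← Finset.sum_add_distrib]
      exact Finset.sum_congr rfl fun i _ => by simp only [Pi.sub_apply]; ring
    have h3 : ip x w = ip x fun i => softThreshold τ (y i) := rfl
    rw [e, e]
    linarith
  have exact_hat : ∀ x, sqnorm (hat x - w) + (sqnorm y - sqnorm w) =
      2 * τ * l1 (hat x) + sqnorm (hat x - y) := by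
    intro x
    simp only [sqnorm, l1, Finset.mul_sum, ← Finset.sum_sub_distrib, ← Finset.sum_add_distrib]
    refine Finset.sum_congr rfl fun i _ => ?_
    have h3 : Real.sign (w i) * (y i - w i) = τ * |Real.sign (w i)| :=
      sign_softThreshold_mul_sub hτ (y i)
    simp only [Pi.sub_apply, hat, abs_mul, abs_abs]
    linear_combination 2 * |x i| * h3
  have hat_le : ∀ x, h (hat x) ≤ h x := fun x => hmono fun i => abs_sign_mul_abs_le _ _
  have sq_hat_le : ∀ x, sqnorm (hat x - w) ≤ sqnorm (x - w) := fun x =>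
    Finset.sum_le_sum fun i _ => sq_sign_mul_abs_sub_le _ _
  have hat_eq : ∀ x, sqnorm (x - w) ≤ sqnorm (hat x - w) → hat x = x := by
    intro x hx
    by_contra hne
    obtain ⟨i, hi⟩ := Function.ne_iff.1 hne
    exact absurd hx <| not_le.2 <| Finset.sum_lt_sum
      (fun i _ => sq_sign_mul_abs_sub_le _ _) ⟨i, Finset.mem_univ i, sq_sign_mul_abs_sub_lt hi⟩
  ext x
  simp only [Set.mem_ofPred_eq]
  constructor
  · intro hx u
    have e : hat x = x := hat_eq x <| by
      linarith [hx (hat x), exact_hat x, lower x, hat_le x]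
    linarith [hx (hat u), exact_hat u, lower x, hat_le u, sq_hat_le u]
  · intro hx u
    have e : hat x = x := hat_eq x <| by linarith [hx (hat x), hat_le x]
    have h1 := exact_hat x
    rw [e] at h1
    linarith [hx u, lower u]

end Conjugate

/-- Proposition 1 of the paper: the proximal operator of
`Q_γ(f + λ‖·‖₁)/ρ` is the proximal operator of `Q_γ(f)/ρ` composed with
soft thresholding. -/
theorem stmt13 {d : ℕ} (f : (Fin d → ℝ) → ℝ) (lam γ ρ : ℝ)
    (hlam : 0 ≤ lam) (hγ : 0 < γ) (hρ : 0 < ρ)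
    (hlsc : LowerSemicontinuous f)
    (hsign : ∀ (ε x : Fin d → ℝ), (∀ i, ε i = 1 ∨ ε i = -1) →
      f (fun i => ε i * x i) = f x)
    (h0 : f 0 = 0)
    (hmono : ∀ x y : Fin d → ℝ, (∀ i, 0 ≤ x i) → (∀ i, 0 ≤ y i) → f x ≤ f (x + y))
    (y : Fin d → ℝ)
    (w : Fin d → ℝ)
    (hw : w = fun i => Real.sign (y i) * max (|y i| - lam / (2 * ρ)) 0) :
    {x : Fin d → ℝ | ∀ u : Fin d → ℝ,
        (1 / ρ) * Qγ γ (fun v => f v + lam * l1 v) x + sqnorm (x - y) ≤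
          (1 / ρ) * Qγ γ (fun v => f v + lam * l1 v) u + sqnorm (u - y)} =
      {x : Fin d → ℝ | ∀ u : Fin d → ℝ,
        (1 / ρ) * Qγ γ f x + sqnorm (x - w) ≤
          (1 / ρ) * Qγ γ f u + sqnorm (u - w)} := by
  have hmonoAbs := absMonotone_of_sign_invariant hsign hmono
  have hf : ∀ x, 0 ≤ f x := fun x => h0 ▸ hmonoAbs fun i => by simp
  have hQ : AbsMonotone fun x => 1 / ρ * Qγ γ f x := fun x x' hx =>
    mul_le_mul_of_nonneg_left (absMonotone_quadraticEnvelope hγ hf hmonoAbs hx) (by positivity)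
  subst hw
  have e : ∀ x : Fin d → ℝ, 1 / ρ * Qγ γ (fun v => f v + lam * l1 v) x =
      1 / ρ * Qγ γ f x + 2 * (lam / (2 * ρ)) * l1 x := fun x => by
    rw [quadraticEnvelope_add_l1 hγ hlam hf hmonoAbs]
    field_simp
  simp only [e]
  exact minimizers_add_l1_eq (by positivity) hQ y
end
end
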